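/- The Grigorchuk group G is infinite. -/

import Mathlib

namespace Grig

def aFun : List Bool → List Bool
  | [] => []
  | x :: v => (!x) :: v

mutual
  def bFun : List Bool → List Bool
    | [] => []
    | false :: v => false :: aFun v
    | true :: v => true :: cFun v
  def cFun : List Bool → List Bool
    | [] => []
    | false :: v => false :: aFun v
    | true :: v => true :: dFun v
  def dFun : List Bool → List Bool
    | [] => []
    | false :: v => false :: v
    | true :: v => true :: bFun v
end

theorem aFun_invol : Function.Involutive aFun := by
  intro v; cases v <;> simp [aFun]

theorem bcd_invol : ∀ v, bFun (bFun v) = v ∧ cFun (cFun v) = v ∧ dFun (dFun v) = v := by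
  intro v
  induction v with
  | nil => simp [bFun, cFun, dFun]
  | cons x v ih =>
    cases x <;> simp [bFun, cFun, dFun, aFun_invol v, ih.1, ih.2.1, ih.2.2]

/-- The automorphism `a` of the binary tree. -/
def a : Equiv.Perm (List Bool) := Function.Involutive.toPerm aFun aFun_invol

def b : Equiv.Perm (List Bool) := Function.Involutive.toPerm bFun (fun v => (bcd_invol v).1)

def c : Equiv.Perm (List Bool) := Function.Involutive.toPerm cFun (fun v => (bcd_invol v).2.1)

def d : Equiv.Perm (List Bool) := Function.Involutive.toPerm dFun (fun v => (bcd_invol v).2.2)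

/-- The Grigorchuk group, as the subgroup generated by `a, b, c, d` inside the
permutation group of the vertex set of the binary tree. -/
def grigG : Subgroup (Equiv.Perm (List Bool)) := Subgroup.closure {a, b, c, d}

end Grig

namespace Grig

theorem a_mem : a ∈ grigG := Subgroup.subset_closure (by simp)
theorem b_mem : b ∈ grigG := Subgroup.subset_closure (by simp)
theorem c_mem : c ∈ grigG := Subgroup.subset_closure (by simp)
theorem d_mem : d ∈ grigG := Subgroup.subset_closure (by simp)

/-- The stabilizer of the right subtree projects onto the whole group. -/
theorem exists_lift {g : Equiv.Perm (List Bool)} (hg : g ∈ grigG) :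
    ∃ h ∈ grigG, ∀ v, h (true :: v) = true :: g v := by
  induction hg using Subgroup.closure_induction with
  | mem x hx =>
    simp only [Set.mem_insert_iff, Set.mem_singleton_iff] at hx
    rcases hx with rfl | rfl | rfl | rfl
    · refine ⟨a * b * a, mul_mem (mul_mem a_mem b_mem) a_mem, fun v => ?_⟩
      change aFun (bFun (aFun (true :: v))) = true :: aFun v
      simp only [aFun, Bool.not_true, bFun, Bool.not_false]
    · exact ⟨d, d_mem, fun v => by
        change dFun (true :: v) = true :: bFun v
        simp only [dFun]⟩
    · exact ⟨b, b_mem, fun v => by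
        change bFun (true :: v) = true :: cFun v
        simp only [bFun]⟩
    · exact ⟨c, c_mem, fun v => by
        change cFun (true :: v) = true :: dFun v
        simp only [cFun]⟩
  | one => exact ⟨1, one_mem _, fun v => rfl⟩
  | mul x y _ _ hx hy =>
    obtain ⟨h, hh, e⟩ := hx
    obtain ⟨k, hk, f⟩ := hy
    exact ⟨h * k, mul_mem hh hk, fun v => by simp [e, f]⟩
  | inv x _ hx =>
    obtain ⟨h, hh, e⟩ := hx
    exact ⟨h⁻¹, inv_mem hh, fun v => by rw [Equiv.Perm.inv_eq_iff_eq, e]; simp⟩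

/-- Every word can be moved to the rightmost word of its level. -/
theorem exists_move (v : List Bool) :
    ∃ g ∈ grigG, g v = List.replicate v.length true := by
  induction v with
  | nil => exact ⟨1, one_mem _, rfl⟩
  | cons x v ih =>
    obtain ⟨g, hg, e⟩ := ih
    obtain ⟨h, hh, f⟩ := exists_lift hg
    cases x
    · exact ⟨h * a, mul_mem hh a_mem, by simp [a, aFun, f, e, List.replicate_succ]⟩
    · exact ⟨h, hh, by simp [f, e, List.replicate_succ]⟩

/-- The Grigorchuk group is infinite. -/
theorem grigG_infinite : Infinite grigG := by
  by_contra hinf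
  rw [not_infinite_iff_finite] at hinf
  have key : ∀ w : List.Vector Bool (Nat.card grigG), ∃ g : grigG,
      g.1 w.1 = List.replicate (Nat.card grigG) true := fun w => by
    obtain ⟨g, hg, e⟩ := exists_move w.1
    exact ⟨⟨g, hg⟩, by rw [e, w.2]⟩
  choose F hF using key
  have inj : Function.Injective F := fun v w hvw => by
    apply Subtype.ext
    apply (F v).1.injective
    rw [hF v, hvw, hF w]
  have hle := Nat.card_le_card_of_injective F inj
  rw [Nat.card_eq_fintype_card (α := List.Vector Bool _), card_vector, Fintype.card_bool] at hle
  exact absurd hle (not_le.mpr Nat.lt_two_pow_self)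

end Grig
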